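/- The Grossman–Larson algebra of S-labelled planar rooted trees is a free associative algebra: the vector space ℚRT(S), equipped with the associative product ⋆₁ and with the root-only tree as unit, is isomorphic as a unital associative ℚ-algebra to the free associative algebra (tensor algebra) on the ℚ-vector space spanned by the set X of S-labelled planar rooted trees whose root has exactly one child, via the unique algebra map sending each generator corresponding to a tree in X to that tree. -/

import Mathlib

/-! S-labelled planar rooted trees: a tree is a root together with a finite ordered
list of branches, a branch being a label in `S` together with a subtree. -/

mutual
/-- An `S`-labelled planar rooted tree: an unlabelled root with an ordered list of branches. -/
inductive PTree (S : Type) : Type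
  | node : Branches S → PTree S

/-- An ordered list of branches; each branch is a label in `S` together with a subtree. -/
inductive Branches (S : Type) : Type
  | nil : Branches S
  | cons : S → PTree S → Branches S → Branches S
end

variable {S : Type}

/-- Concatenation of branch lists. -/
def Branches.append : Branches S → Branches S → Branches S
  | .nil, c => c
  | .cons s t rest, c => .cons s t (Branches.append rest c)

/-- The number of branches in a list. -/
def Branches.len : Branches S → ℕ
  | .nil => 0
  | .cons _ _ rest => Branches.len rest + 1

mutual
/-- The list of arities (numbers of children) of the vertices of a tree,
in preorder (root first, then the subtrees from left to right). -/
def PTree.arities : PTree S → List ℕ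
  | .node b => Branches.len b :: Branches.arities b

/-- The concatenated preorder arity lists of the subtrees of a branch list. -/
def Branches.arities : Branches S → List ℕ
  | .nil => []
  | .cons _ t rest => PTree.arities t ++ Branches.arities rest
end

/-- The number of vertices of a tree (including the root). -/
def PTree.nv (T : PTree S) : ℕ := T.arities.length

/-- The degree of a tree: its number of non-root vertices. -/
def PTree.deg (T : PTree S) : ℕ := T.nv - 1

/-- The number of children of the root. -/
def PTree.rootArity : PTree S → ℕ
  | .node b => Branches.len b

/-- The list of branches at the root. -/
def PTree.branches : PTree S → Branches S
  | .node b => b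

mutual
/-- Graft, for every vertex `v` of the tree (indexed in preorder), the branch list `φ v`
at `v`, placing the grafted branches to the left of the existing children of `v`. -/
def PTree.graft : PTree S → (ℕ → Branches S) → PTree S
  | .node b, φ => .node (Branches.append (φ 0) (Branches.graftB b (fun n => φ (n + 1))))

/-- Graft branch lists into all subtrees of a branch list, the vertex indices being
distributed in preorder. -/
def Branches.graftB : Branches S → (ℕ → Branches S) → Branches S
  | .nil, _ => .nil
  | .cons s t rest, φ =>
      .cons s (PTree.graft t φ)
        (Branches.graftB rest (fun n => φ (n + (PTree.arities t).length)))
end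

/-- The sublist of a branch list consisting of the branches whose position (counted from 0)
satisfies the predicate, in their original order. -/
def Branches.filterIdx : Branches S → (ℕ → Bool) → Branches S
  | .nil, _ => .nil
  | .cons s t rest, p =>
      if p 0 then .cons s t (Branches.filterIdx rest (fun n => p (n + 1)))
      else Branches.filterIdx rest (fun n => p (n + 1))

/-- The tree `T₁ ∘^f T₂` for a function `f` from the root-branches of `T₁` to the
(preorder-indexed) vertices of `T₂`: graft, at each vertex `v` of `T₂`, the branches of
`T₁` lying over `v`, in order, to the left of the existing children of `v`. -/
def graftAlong (T₁ T₂ : PTree S) (f : Fin T₁.rootArity → Fin T₂.nv) : PTree S :=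
  T₂.graft fun v => T₁.branches.filterIdx fun i =>
    if h : i < T₁.rootArity then decide ((f ⟨i, h⟩ : ℕ) = v) else false

/-- The product `T₁ ⋆₁ T₂` of two trees: the sum of `T₁ ∘^f T₂` over all functions `f`
from the root-branches of `T₁` to the vertices of `T₂`. -/
noncomputable def treeProd1 (T₁ T₂ : PTree S) : PTree S →₀ ℚ :=
  ∑ f : Fin T₁.rootArity → Fin T₂.nv, Finsupp.single (graftAlong T₁ T₂ f) 1

/-- Vertex number `v` (in preorder) of `T` is internal, i.e. has at least one child. -/
def PTree.isInternal (T : PTree S) (v : ℕ) : Prop := T.arities.getD v 0 ≠ 0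

open Classical in
/-- The product `T₁ ⋆₂ T₂` of two trees: the sum of `T₁ ∘^g T₂` over all functions `g`
from the root-branches of `T₁` to the internal vertices of `T₂`. -/
noncomputable def treeProd2 (T₁ T₂ : PTree S) : PTree S →₀ ℚ :=
  ∑ f : Fin T₁.rootArity → Fin T₂.nv,
    if ∀ i, T₂.isInternal (f i) then Finsupp.single (graftAlong T₁ T₂ f) 1 else 0

/-- The bilinear extension to `ℚRT(S)` of a product of trees with values in `ℚRT(S)`. -/
noncomputable def starLin (P : PTree S → PTree S → (PTree S →₀ ℚ)) :
    (PTree S →₀ ℚ) →ₗ[ℚ] (PTree S →₀ ℚ) →ₗ[ℚ] (PTree S →₀ ℚ) :=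
  Finsupp.lsum ℚ fun T₁ =>
    LinearMap.toSpanSingleton ℚ _
      (Finsupp.lsum ℚ fun T₂ => LinearMap.toSpanSingleton ℚ _ (P T₁ T₂))

/-- The first product `⋆₁` (the Grossman–Larson product) on `ℚRT(S)`. -/
noncomputable def star1 (x y : PTree S →₀ ℚ) : PTree S →₀ ℚ := starLin treeProd1 x y

/-- The second product `⋆₂` on `ℚRT(S)`. -/
noncomputable def star2 (x y : PTree S →₀ ℚ) : PTree S →₀ ℚ := starLin treeProd2 x y



mutual
/-- The multiset of trees obtained by grafting the branch `(a, τ)` at some vertex of a tree,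
to the left of the existing children. -/
def PTree.leftGraft (a : S) (τ : PTree S) : PTree S → Multiset (PTree S)
  | .node b => {.node (.cons a τ b)} + (Branches.leftGraft a τ b).map .node

/-- The multiset of branch lists obtained by grafting the branch `(a, τ)` at some vertex of
one of the subtrees of a branch list. -/
def Branches.leftGraft (a : S) (τ : PTree S) : Branches S → Multiset (Branches S)
  | .nil => 0
  | .cons s t r => (PTree.leftGraft a τ t).map (fun t' => .cons s t' r) +
      (Branches.leftGraft a τ r).map (.cons s t)
end

/-- All ways to split a branch list into two complementary sublists. -/
def Branches.splits : Branches S → Multiset (Branches S × Branches S)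
  | .nil => {(.nil, .nil)}
  | .cons s t r => r.splits.bind fun p => {(.cons s t p.1, p.2)} + {(p.1, .cons s t p.2)}

mutual
/-- All ways to graft the branches of a list at the vertices of a tree. -/
def PTree.graftAll : PTree S → Branches S → Multiset (PTree S)
  | .node b, w => w.splits.bind fun p =>
      (Branches.graftAll b p.2).map fun b' => .node (p.1.append b')

/-- All ways to graft the branches of a list at the vertices of the subtrees of a branch
list. -/
def Branches.graftAll : Branches S → Branches S → Multiset (Branches S)
  | .nil, .nil => {.nil}
  | .nil, .cons _ _ _ => 0
  | .cons s t r, w => w.splits.bind fun p =>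
      (PTree.graftAll t p.1).bind fun t' => (Branches.graftAll r p.2).map (.cons s t')
end

/-- The multiset of branch lists obtained by grafting the branch `(a, τ)` at some vertex of
the tree whose root carries the given branch list. -/
def Branches.leftGraftRoot (a : S) (τ : PTree S) (w : Branches S) : Multiset (Branches S) :=
  {.cons a τ w} + w.leftGraft a τ

section
variable {α : Type*} (a : S) (τ : PTree S)

theorem PTree.leftGraft_node (b : Branches S) :
    PTree.leftGraft a τ (.node b) = (b.leftGraftRoot a τ).map .node := by
  simp [PTree.leftGraft, Branches.leftGraftRoot]

theorem Branches.leftGraft_append (u b : Branches S) :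
    (u.append b).leftGraft a τ =
      (u.leftGraft a τ).map (·.append b) + (b.leftGraft a τ).map u.append := by
  match u with
  | .nil => simp [Branches.append, Branches.leftGraft]
  | .cons s t r =>
    simp [Branches.append, Branches.leftGraft, Branches.leftGraft_append r, add_assoc,
      Function.comp_def]

theorem Branches.leftGraft_bind_splits (w : Branches S)
    (F : Branches S × Branches S → Multiset α) :
    ((w.leftGraft a τ).bind fun w' => w'.splits.bind F) =
      w.splits.bind fun p => ((p.1.leftGraft a τ).bind fun u => F (u, p.2)) +
        ((p.2.leftGraft a τ).bind fun v => F (p.1, v)) := by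
  match w with
  | .nil => simp [Branches.leftGraft, Branches.splits]
  | .cons s t r =>
    simp only [Branches.leftGraft, Branches.splits, Multiset.add_bind, Multiset.bind_map,
      Multiset.bind_assoc, Multiset.singleton_bind, Multiset.bind_add,
      Branches.leftGraft_bind_splits r]
    rw [Multiset.bind_bind (m := PTree.leftGraft a τ t),
      Multiset.bind_bind (m := PTree.leftGraft a τ t)]
    abel

theorem Branches.leftGraftRoot_bind_splits (w : Branches S)
    (F : Branches S × Branches S → Multiset α) :
    ((w.leftGraftRoot a τ).bind fun w' => w'.splits.bind F) =
      w.splits.bind fun p => ((p.1.leftGraftRoot a τ).bind fun u => F (u, p.2)) +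
        ((p.2.leftGraftRoot a τ).bind fun v => F (p.1, v)) := by
  simp only [Branches.leftGraftRoot, Branches.splits, Multiset.add_bind,
    Multiset.bind_assoc, Multiset.singleton_bind, Multiset.bind_add,
    Branches.leftGraft_bind_splits]
  abel

mutual
theorem PTree.graftAll_bind_leftGraft (T : PTree S) (w : Branches S) :
    (T.graftAll w).bind (PTree.leftGraft a τ) =
      (w.leftGraftRoot a τ).bind T.graftAll := by
  match T with
  | .node b =>
    have h : PTree.graftAll (.node b) = fun w : Branches S => w.splits.bind fun p =>
        (Branches.graftAll b p.2).map fun b' => .node (p.1.append b') := by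
      funext w; rw [PTree.graftAll]
    rw [h, Branches.leftGraftRoot_bind_splits]
    simp only [Multiset.bind_assoc, Multiset.bind_map]
    refine Multiset.bind_congr fun p _ => ?_
    rw [← Multiset.map_bind, ← Branches.graftAll_bind_leftGraft b p.2, Multiset.map_bind]
    simp only [PTree.leftGraft, Branches.leftGraftRoot, Branches.leftGraft_append,
      Multiset.add_bind, Multiset.bind_add, Multiset.map_add, Multiset.singleton_bind,
      Multiset.map_map, Function.comp_def, Branches.append, Multiset.bind_singleton]
    rw [Multiset.bind_map_comm]
    abel

theorem Branches.graftAll_bind_leftGraft (b : Branches S) (w : Branches S) :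
    (b.graftAll w).bind (Branches.leftGraft a τ) =
      (w.leftGraftRoot a τ).bind b.graftAll := by
  match b with
  | .nil =>
    match w with
    | .nil => simp [Branches.graftAll, Branches.leftGraft, Branches.leftGraftRoot]
    | .cons s t r =>
      simp [Branches.graftAll, Branches.leftGraft, Branches.leftGraftRoot, Multiset.bind_map]
  | .cons s t r =>
    have h : Branches.graftAll (.cons s t r) = fun w : Branches S => w.splits.bind fun p =>
      (PTree.graftAll t p.1).bind fun t' => (Branches.graftAll r p.2).map (.cons s t') := by
      funext w; rw [Branches.graftAll]
    rw [h, Branches.leftGraftRoot_bind_splits]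
    simp only [Multiset.bind_assoc, Multiset.bind_map]
    refine Multiset.bind_congr fun p _ => ?_
    rw [← Multiset.bind_assoc, ← PTree.graftAll_bind_leftGraft t p.1,
      Multiset.bind_bind (m := p.2.leftGraftRoot a τ)]
    simp only [← Multiset.map_bind]
    rw [← Branches.graftAll_bind_leftGraft r p.2]
    simp only [Branches.leftGraft, Multiset.bind_add, Multiset.bind_assoc, Multiset.map_bind]
    congr 1
    refine Multiset.bind_congr fun t' _ => ?_
    rw [Multiset.bind_map_comm]
end

mutual
theorem PTree.graftAll_nil (T : PTree S) : T.graftAll .nil = {T} := by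
  match T with
  | .node b => simp [PTree.graftAll, Branches.splits, Branches.graftAll_nil b, Branches.append]

theorem Branches.graftAll_nil (b : Branches S) : b.graftAll .nil = {b} := by
  match b with
  | .nil => rfl
  | .cons s t r =>
    simp [Branches.graftAll, Branches.splits, PTree.graftAll_nil t, Branches.graftAll_nil r]
end

mutual
theorem PTree.graftAll_singleton (T : PTree S) :
    T.graftAll (.cons a τ .nil) = PTree.leftGraft a τ T := by
  match T with
  | .node b =>
    simp [PTree.graftAll, Branches.splits, Branches.graftAll_nil, Branches.append,
      PTree.leftGraft, Branches.graftAll_singleton b]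

theorem Branches.graftAll_singleton (b : Branches S) :
    b.graftAll (.cons a τ .nil) = b.leftGraft a τ := by
  match b with
  | .nil => rfl
  | .cons s t r =>
    simp [Branches.graftAll, Branches.splits, PTree.graftAll_nil, Branches.graftAll_nil,
      PTree.graftAll_singleton t, Branches.graftAll_singleton r, Branches.leftGraft,
      Multiset.bind_singleton]
end

theorem Branches.len_of_mem_leftGraft {b c : Branches S} (h : c ∈ b.leftGraft a τ) :
    c.len = b.len := by
  match b with
  | .nil => simp [Branches.leftGraft] at h
  | .cons s t r =>
    simp only [Branches.leftGraft, Multiset.mem_add, Multiset.mem_map] at h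
    rcases h with ⟨t', -, rfl⟩ | ⟨r', h, rfl⟩
    · rfl
    · simp [Branches.len, Branches.len_of_mem_leftGraft h]

end

/-- All ways to distribute the branches of a list over `n` places. -/
def Branches.distributions : Branches S → ℕ → Multiset (ℕ → Branches S)
  | .nil, _ => {fun _ => .nil}
  | .cons s t r, n => (Branches.distributions r n).bind fun φ =>
      (Multiset.range n).map fun v => Function.update φ v (.cons s t (φ v))

theorem Branches.sum_filterIdx {A : Type*} [AddCommMonoid A] (n : ℕ) (w : Branches S)
    (F : (ℕ → Branches S) → A) :
    (∑ f : Fin w.len → Fin n, F fun v => w.filterIdx fun i =>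
      if h : i < w.len then decide ((f ⟨i, h⟩ : ℕ) = v) else false) =
      ((w.distributions n).map F).sum := by
  match w with
  | .nil =>
    change (∑ _ : Fin 0 → Fin n, F fun _ => .nil) = _
    simp [Branches.distributions]
  | .cons s t r =>
    rw [Branches.distributions, Multiset.map_bind, Multiset.sum_bind]
    rw [← Branches.sum_filterIdx n r]
    change (∑ f : Fin (r.len + 1) → Fin n, _) = _
    rw [← (Fin.consEquiv fun _ => Fin n).sum_comp, Fintype.sum_prod_type, Finset.sum_comm]
    refine Finset.sum_congr rfl fun g _ => ?_
    rw [Multiset.map_map, ← Finset.range_val]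
    change _ = ∑ v ∈ Finset.range n, _
    rw [Finset.sum_range]
    refine Finset.sum_congr rfl fun v _ => ?_
    simp only [Function.comp_apply]
    congr 1
    funext v'
    have h0 : ∀ i (h : i + 1 < r.len + 1), (Fin.cons v g : Fin (r.len + 1) → Fin n) ⟨i + 1, h⟩
      = g ⟨i, by omega⟩ := fun i h => rfl
    by_cases hv : (v : ℕ) = v'
    · subst hv
      simp [Branches.filterIdx, Branches.len, Fin.consEquiv, h0]
    · simp [Branches.filterIdx, Branches.len, Fin.consEquiv, h0, hv,
        Function.update_of_ne (Ne.symm hv)]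

/-- Concatenation of a finite sequence of length `m` with an infinite sequence. -/
def joinAt {α : Type*} (m : ℕ) (φ ψ : ℕ → α) (i : ℕ) : α := if i < m then φ i else ψ (i - m)

theorem Branches.distributions_add (m n : ℕ) (w : Branches S) :
    w.distributions (m + n) = w.splits.bind fun p =>
      (p.1.distributions m).bind fun φ => (p.2.distributions n).map (joinAt m φ) := by
  match w with
  | .nil =>
    simp [Branches.distributions, Branches.splits]
    funext i
    simp [joinAt]
  | .cons s t r =>
    simp only [Branches.distributions, Branches.splits, Branches.distributions_add m n r,
      Multiset.bind_assoc, Multiset.bind_map, Multiset.add_bind, Multiset.singleton_bind,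
      Multiset.map_bind, Multiset.range_add, Multiset.map_add, Multiset.map_map, Multiset.bind_add]
    congr 1
    · refine Multiset.bind_congr fun p _ => Multiset.bind_congr fun φ _ => ?_
      rw [Multiset.bind_map_comm]
      refine Multiset.bind_congr fun v hv => Multiset.map_congr rfl fun ψ _ => ?_
      rw [Multiset.mem_range] at hv
      funext i
      by_cases h : i = v
      · subst h; simp [joinAt, hv]
      · simp [joinAt, h]
    · refine Multiset.bind_congr fun p _ => Multiset.bind_congr fun φ _ =>
        Multiset.bind_congr fun ψ _ => Multiset.map_congr rfl fun v _ => ?_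
      funext i
      by_cases h : i = m + v
      · subst h; simp [joinAt]
      · simp only [Function.comp_apply, joinAt, Function.update_of_ne h]
        split_ifs with h1
        · rfl
        · rw [Function.update_of_ne (by omega)]

theorem Branches.distributions_one (w : Branches S) :
    w.distributions 1 = {fun i => if i = 0 then w else .nil} := by
  match w with
  | .nil => simp [Branches.distributions]
  | .cons s t r =>
    simp only [Branches.distributions, Branches.distributions_one r, Multiset.singleton_bind]
    simp [Multiset.range_succ]
    funext i
    by_cases h : i = 0
    · subst h; simp
    · simp [h]

mutual
theorem PTree.graft_congr (T : PTree S) {φ ψ : ℕ → Branches S}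
    (h : ∀ i < T.arities.length, φ i = ψ i) : T.graft φ = T.graft ψ := by
  match T with
  | .node b =>
    simp only [PTree.arities, List.length_cons] at h
    rw [PTree.graft, PTree.graft, h 0 (by omega),
      Branches.graftB_congr b fun i hi => h (i + 1) (by omega)]

theorem Branches.graftB_congr (b : Branches S) {φ ψ : ℕ → Branches S}
    (h : ∀ i < b.arities.length, φ i = ψ i) : b.graftB φ = b.graftB ψ := by
  match b with
  | .nil => rfl
  | .cons s t r =>
    simp only [Branches.arities, List.length_append] at h
    rw [Branches.graftB, Branches.graftB, PTree.graft_congr t fun i hi => h i (by omega),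
      Branches.graftB_congr r fun i hi => h (i + t.arities.length) (by omega)]
end

mutual
theorem PTree.map_graft_distributions (T : PTree S) (w : Branches S) :
    (w.distributions T.arities.length).map T.graft = T.graftAll w := by
  match T with
  | .node b =>
    rw [PTree.arities, List.length_cons, add_comm, Branches.distributions_add, PTree.graftAll]
    simp only [Branches.distributions_one, Multiset.singleton_bind, Multiset.map_bind,
      Multiset.map_map, ← Branches.map_graftB_distributions b]
    refine Multiset.bind_congr fun p _ => Multiset.map_congr rfl fun φ _ => ?_
    simp [PTree.graft, joinAt]

theorem Branches.map_graftB_distributions (b : Branches S) (w : Branches S) :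
    (w.distributions b.arities.length).map b.graftB = b.graftAll w := by
  match b with
  | .nil =>
    match w with
    | .nil => simp [Branches.distributions, Branches.graftAll, Branches.graftB]
    | .cons s t r => simp [Branches.distributions, Branches.graftAll, Branches.arities]
  | .cons s t r =>
    rw [Branches.arities, List.length_append, Branches.distributions_add, Branches.graftAll]
    simp only [Multiset.map_bind, Multiset.map_map, Multiset.bind_map,
      ← Branches.map_graftB_distributions r, ← PTree.map_graft_distributions t]
    refine Multiset.bind_congr fun p _ => Multiset.bind_congr fun φ _ =>
      Multiset.map_congr rfl fun ψ _ => ?_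
    simp only [Function.comp_apply, Branches.graftB]
    congr 1
    · exact PTree.graft_congr t fun i hi => by simp [joinAt, hi]
    · exact Branches.graftB_congr r fun i _ => by simp [joinAt]
end

/-- The formal sum of a multiset of trees. -/
noncomputable def formalSum (m : Multiset (PTree S)) : PTree S →₀ ℚ :=
  (m.map fun T => Finsupp.single T 1).sum

theorem formalSum_add (m n : Multiset (PTree S)) :
    formalSum (m + n) = formalSum m + formalSum n := by simp [formalSum]

theorem formalSum_singleton (T : PTree S) : formalSum {T} = Finsupp.single T 1 := by
  simp [formalSum]

theorem map_formalSum {A : Type*} [AddCommGroup A] [Module ℚ A] (f : (PTree S →₀ ℚ) →ₗ[ℚ] A)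
    (m : Multiset (PTree S)) :
    f (formalSum m) = (m.map fun T => f (Finsupp.single T 1)).sum := by
  simp [formalSum, map_multiset_sum]

theorem formalSum_bind {α : Type*} (m : Multiset α) (f : α → Multiset (PTree S)) :
    formalSum (m.bind f) = (m.map fun x => formalSum (f x)).sum := by
  simp [formalSum, Multiset.map_bind, Multiset.sum_bind]

theorem treeProd1_node (w : Branches S) (T : PTree S) :
    treeProd1 (.node w) T = formalSum (T.graftAll w) := by
  rw [← PTree.map_graft_distributions, formalSum, Multiset.map_map,
    ← Branches.sum_filterIdx]
  rfl

theorem starLin_treeProd1_single (w : Branches S) (T : PTree S) :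
    starLin treeProd1 (Finsupp.single (.node w) 1) (Finsupp.single T 1) =
      formalSum (T.graftAll w) := by
  simp [starLin, treeProd1_node]

/-- The tree whose root has exactly one child, labelled `a` and carrying the subtree `τ`. -/
def planted (a : S) (τ : PTree S) : {T : PTree S // T.rootArity = 1} :=
  ⟨.node (.cons a τ .nil), rfl⟩

theorem exists_eq_planted (x : {T : PTree S // T.rootArity = 1}) : ∃ a τ, x = planted a τ := by
  match x with
  | ⟨.node .nil, h⟩ => exact absurd h (by simp [PTree.rootArity, Branches.len])
  | ⟨.node (.cons a τ .nil), h⟩ => exact ⟨a, τ, rfl⟩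
  | ⟨.node (.cons a τ (.cons _ _ _)), h⟩ =>
    exact absurd h (by simp [PTree.rootArity, Branches.len])

theorem starLin_planted (a : S) (τ : PTree S) (w : Branches S) :
    starLin treeProd1 (Finsupp.single (planted a τ : PTree S) 1) (Finsupp.single (.node w) 1) =
      formalSum ((w.leftGraftRoot a τ).map .node) := by
  rw [planted, starLin_treeProd1_single, PTree.graftAll_singleton, PTree.leftGraft_node]

theorem starLin_formalSum (P : PTree S → PTree S → (PTree S →₀ ℚ)) (m : Multiset (PTree S))
    (v : PTree S →₀ ℚ) :
    starLin P (formalSum m) v =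
      (m.map fun T => starLin P (Finsupp.single T 1) v).sum :=
  map_formalSum ((starLin P).flip v) m

theorem starLin_planted_assoc (x : {T : PTree S // T.rootArity = 1}) (v : PTree S →₀ ℚ) :
    starLin treeProd1 (starLin treeProd1 (Finsupp.single (x : PTree S) 1) v) =
      starLin treeProd1 (Finsupp.single (x : PTree S) 1) ∘ₗ starLin treeProd1 v := by
  obtain ⟨a, τ, rfl⟩ := exists_eq_planted x
  induction v using Finsupp.induction_linear with
  | zero => simp
  | add f g hf hg => simp only [map_add, hf, hg, LinearMap.comp_add]
  | single T c =>
    rw [← mul_one c, ← smul_eq_mul, ← Finsupp.smul_single]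
    simp only [map_smul, LinearMap.comp_smul]
    congr 1
    obtain ⟨w⟩ := T
    refine Finsupp.lhom_ext' fun U => LinearMap.ext_ring ?_
    simp only [LinearMap.comp_apply, Finsupp.lsingle_apply]
    rw [starLin_planted, starLin_treeProd1_single, starLin_formalSum,
      map_formalSum]
    simp only [Multiset.map_map, Function.comp_def, starLin_treeProd1_single]
    rw [← formalSum_bind, ← PTree.graftAll_bind_leftGraft, formalSum_bind]
    simp only [planted, starLin_treeProd1_single, PTree.graftAll_singleton]

/-- The action of the tensor algebra on formal sums of trees by left multiplication. -/
noncomputable def tensorAction (S : Type) :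
    TensorAlgebra ℚ ({T : PTree S // T.rootArity = 1} →₀ ℚ) →ₐ[ℚ]
      Module.End ℚ (PTree S →₀ ℚ) :=
  TensorAlgebra.lift ℚ (starLin treeProd1 ∘ₗ
    Finsupp.linearCombination ℚ fun x : {T : PTree S // T.rootArity = 1} =>
      Finsupp.single (x : PTree S) 1)

theorem tensorAction_ι (x : {T : PTree S // T.rootArity = 1}) :
    tensorAction S (TensorAlgebra.ι ℚ (Finsupp.single x 1)) =
      starLin treeProd1 (Finsupp.single (x : PTree S) 1) := by
  simp [tensorAction]

/-- The linear map underlying the algebra map from the tensor algebra to formal sums of trees. -/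
noncomputable def ofTensor (S : Type) :
    TensorAlgebra ℚ ({T : PTree S // T.rootArity = 1} →₀ ℚ) →ₗ[ℚ] (PTree S →₀ ℚ) :=
  LinearMap.applyₗ (Finsupp.single (.node .nil) 1) ∘ₗ (tensorAction S).toLinearMap

theorem ofTensor_apply (a : TensorAlgebra ℚ ({T : PTree S // T.rootArity = 1} →₀ ℚ)) :
    ofTensor S a = tensorAction S a (Finsupp.single (.node .nil) 1) := rfl

theorem tensorAlgebra_induction
    {P : TensorAlgebra ℚ ({T : PTree S // T.rootArity = 1} →₀ ℚ) → Prop}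
    (one : P 1) (add : ∀ a b, P a → P b → P (a + b)) (smul : ∀ (c : ℚ) a, P a → P (c • a))
    (ι_mul : ∀ x a, P a → P (TensorAlgebra.ι ℚ (Finsupp.single x 1) * a)) (a) : P a := by
  have key : ∀ a b, P b → P (a * b) := by
    intro a
    induction a using TensorAlgebra.induction with
    | algebraMap r =>
      intro b hb
      rw [← Algebra.smul_def]
      exact smul r b hb
    | ι x =>
      intro b hb
      induction x using Finsupp.induction_linear with
      | zero => simpa using smul 0 b hb
      | add f g hf hg => rw [map_add, add_mul]; exact add _ _ hf hg
      | single x c =>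
        rw [← mul_one c, ← smul_eq_mul c, ← Finsupp.smul_single, map_smul, smul_mul_assoc]
        exact smul _ _ (ι_mul x b hb)
    | mul a b ha hb => intro c hc; rw [mul_assoc]; exact ha _ (hb _ hc)
    | add a b ha hb => intro c hc; rw [add_mul]; exact add _ _ (ha _ hc) (hb _ hc)
  simpa using key a 1 one

theorem ofTensor_one : ofTensor S 1 = Finsupp.single (.node .nil) 1 := by
  simp [ofTensor_apply]

theorem ofTensor_ι_mul (x : {T : PTree S // T.rootArity = 1})
    (a : TensorAlgebra ℚ ({T : PTree S // T.rootArity = 1} →₀ ℚ)) :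
    ofTensor S (TensorAlgebra.ι ℚ (Finsupp.single x 1) * a) =
      starLin treeProd1 (Finsupp.single (x : PTree S) 1) (ofTensor S a) := by
  rw [ofTensor_apply, map_mul, tensorAction_ι, Module.End.mul_apply, ofTensor_apply]

theorem tensorAction_eq (a : TensorAlgebra ℚ ({T : PTree S // T.rootArity = 1} →₀ ℚ)) :
    tensorAction S a = starLin treeProd1 (ofTensor S a) := by
  induction a using tensorAlgebra_induction with
  | one =>
    rw [map_one, ofTensor_one]
    refine Finsupp.lhom_ext' fun U => LinearMap.ext_ring ?_
    simp [starLin_treeProd1_single, PTree.graftAll_nil, formalSum_singleton]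
  | add a b ha hb => simp only [map_add, ha, hb]
  | smul c a ha => simp only [map_smul, ha]
  | ι_mul x a ha => rw [map_mul, tensorAction_ι, ofTensor_ι_mul, starLin_planted_assoc, ← ha]; rfl

/-- The recursion `x · w ↦ x ⊗ w - x ▷ w` on branch lists of length at most `n`, for `x` a
single branch and `x ▷ w` the sum of all graftings of `x` at a non-root vertex of `w`. -/
noncomputable def Branches.toTensor :
    ℕ → Branches S → TensorAlgebra ℚ ({T : PTree S // T.rootArity = 1} →₀ ℚ)
  | _, .nil => 1
  | 0, .cons _ _ _ => 0
  | n + 1, .cons a τ r => TensorAlgebra.ι ℚ (Finsupp.single (planted a τ) 1) *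
      Branches.toTensor n r - ((r.leftGraft a τ).map (Branches.toTensor n)).sum

/-- The inverse of `ofTensor`. -/
noncomputable def toTensor (S : Type) :
    (PTree S →₀ ℚ) →ₗ[ℚ] TensorAlgebra ℚ ({T : PTree S // T.rootArity = 1} →₀ ℚ) :=
  Finsupp.linearCombination ℚ fun T => T.branches.toTensor T.rootArity

theorem toTensor_single (w : Branches S) :
    toTensor S (Finsupp.single (.node w) 1) = w.toTensor w.len := by
  rw [toTensor, Finsupp.linearCombination_single, one_smul, PTree.branches, PTree.rootArity]

theorem toTensor_nil : toTensor S (Finsupp.single (.node .nil) 1) = 1 := by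
  rw [toTensor_single, Branches.toTensor]

theorem toTensor_starLin (x : {T : PTree S // T.rootArity = 1}) (v : PTree S →₀ ℚ) :
    toTensor S (starLin treeProd1 (Finsupp.single (x : PTree S) 1) v) =
      TensorAlgebra.ι ℚ (Finsupp.single x 1) * toTensor S v := by
  obtain ⟨a, τ, rfl⟩ := exists_eq_planted x
  induction v using Finsupp.induction_linear with
  | zero => simp
  | add f g hf hg => simp only [map_add, hf, hg, mul_add]
  | single T c =>
    rw [← mul_one c, ← smul_eq_mul, ← Finsupp.smul_single]
    simp only [map_smul, mul_smul_comm]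
    congr 1
    obtain ⟨w⟩ := T
    rw [starLin_planted, map_formalSum, toTensor_single, Multiset.map_map,
      Branches.leftGraftRoot, Multiset.map_add, Multiset.sum_add, Multiset.map_singleton,
      Multiset.sum_singleton, Function.comp_apply, toTensor_single, Branches.len,
      Branches.toTensor]
    have h : (w.leftGraft a τ).map ((fun T => toTensor S (Finsupp.single T 1)) ∘ PTree.node) =
        (w.leftGraft a τ).map (Branches.toTensor w.len) :=
      Multiset.map_congr rfl fun b hb => by
        rw [Function.comp_apply, toTensor_single, Branches.len_of_mem_leftGraft _ _ hb]
    rw [h, sub_add_cancel]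

theorem toTensor_ofTensor (a : TensorAlgebra ℚ ({T : PTree S // T.rootArity = 1} →₀ ℚ)) :
    toTensor S (ofTensor S a) = a := by
  induction a using tensorAlgebra_induction with
  | one => rw [ofTensor_one, toTensor_nil]
  | add a b ha hb => simp only [map_add, ha, hb]
  | smul c a ha => simp only [map_smul, ha]
  | ι_mul x a ha => rw [ofTensor_ι_mul, toTensor_starLin, ha]

theorem ofTensor_toTensor_single (n : ℕ) (w : Branches S) (hw : w.len = n) :
    ofTensor S (toTensor S (Finsupp.single (.node w) 1)) = Finsupp.single (.node w) 1 := by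
  match n, w with
  | _, .nil => rw [toTensor_nil, ofTensor_one]
  | 0, .cons _ _ _ => simp [Branches.len] at hw
  | n + 1, .cons a τ r =>
    have hr : r.len = n := by simpa [Branches.len] using hw
    have h := congrArg (ofTensor S)
      (toTensor_starLin (planted a τ) (Finsupp.single (.node r) 1))
    rw [ofTensor_ι_mul, ofTensor_toTensor_single n r hr, starLin_planted, Branches.leftGraftRoot,
      Multiset.map_add, formalSum_add, map_add, map_add, Multiset.map_singleton,
      formalSum_singleton] at h
    have h' : ofTensor S (toTensor S (formalSum ((r.leftGraft a τ).map .node))) =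
        formalSum ((r.leftGraft a τ).map .node) := by
      rw [← LinearMap.comp_apply, map_formalSum, formalSum, Multiset.map_map, Multiset.map_map]
      refine congrArg _ (Multiset.map_congr rfl fun b hb => ?_)
      exact ofTensor_toTensor_single n b ((Branches.len_of_mem_leftGraft _ _ hb).trans hr)
    rw [h'] at h
    exact add_right_cancel h

theorem ofTensor_toTensor (v : PTree S →₀ ℚ) : ofTensor S (toTensor S v) = v := by
  have h : ofTensor S ∘ₗ toTensor S = LinearMap.id :=
    Finsupp.lhom_ext' fun T => LinearMap.ext_ring <| by
      obtain ⟨w⟩ := T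
      exact ofTensor_toTensor_single _ w rfl
  exact LinearMap.congr_fun h v

/-- The Grossman–Larson algebra of `S`-labelled planar rooted trees is a free associative
algebra: `ℚRT(S)` with the product `⋆₁` and the root-only tree as unit is isomorphic, as a
unital associative `ℚ`-algebra, to the tensor algebra on the `ℚ`-vector space spanned by
the set of trees whose root has exactly one child, via the algebra map sending each such
generator to the corresponding tree. -/
theorem grossman_larson_free (S : Type) :
    ∃ e : TensorAlgebra ℚ ({T : PTree S // T.rootArity = 1} →₀ ℚ)
            ≃ₗ[ℚ] (PTree S →₀ ℚ),
      e 1 = Finsupp.single (PTree.node Branches.nil) (1 : ℚ) ∧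
      (∀ a b, e (a * b) = star1 (e a) (e b)) ∧
      (∀ x : {T : PTree S // T.rootArity = 1},
        e (TensorAlgebra.ι ℚ (Finsupp.single x (1 : ℚ)))
          = Finsupp.single (x : PTree S) (1 : ℚ)) := by
  refine ⟨LinearEquiv.ofLinearMap (ofTensor S) (toTensor S) (LinearMap.ext ofTensor_toTensor)
    (LinearMap.ext toTensor_ofTensor), ofTensor_one, fun a b => ?_, fun x => ?_⟩
  · change ofTensor S (a * b) = starLin treeProd1 (ofTensor S a) (ofTensor S b)
    rw [← tensorAction_eq, ofTensor_apply, map_mul, Module.End.mul_apply, ofTensor_apply]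
  · change ofTensor S _ = _
    obtain ⟨a, τ, rfl⟩ := exists_eq_planted x
    rw [ofTensor_apply, tensorAction_ι, starLin_planted]
    simp [Branches.leftGraftRoot, Branches.leftGraft, formalSum_singleton, planted]
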